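/- arXiv:2010.01984 — 9 statements merged into one kernel-verified Lean document; each statement's English description precedes it below -/
import Mathlib

section
/- Let X be a metric space and G a nonempty, open, proper subset of X whose boundary ∂G is nonempty. For x ∈ G set d_G(x) = inf{dist(x,z) : z ∈ ∂G}. Then the function t_G(x,y) = dist(x,y) / (dist(x,y) + d_G(x) + d_G(y)) is a metric on G: t_G(x,y) ≥ 0 with t_G(x,y) = 0 if and only if x = y, t_G(x,y) = t_G(y,x), and t_G(x,y) ≤ t_G(x,z) + t_G(z,y) for all x, y, z ∈ G. -/
theorem infDist_frontier_pos_of_isOpen {X : Type*} [PseudoMetricSpace X] {G : Set X}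
    (hopen : IsOpen G) (hfr : (frontier G).Nonempty) {x : X} (hx : x ∈ G) :
    0 < Metric.infDist x (frontier G) := by
  refine (isClosed_frontier.notMem_iff_infDist_pos hfr).1 fun h => ?_
  rw [hopen.frontier_eq] at h
  exact h.2 hx

theorem div_add_add_le_div_add_div {p a b u v w : ℝ} (hp : 0 ≤ p) (ha : 0 ≤ a) (hb : 0 ≤ b)
    (hu : 0 < u) (hv : 0 < v) (hw : 0 < w) (hpab : p ≤ a + b) (hwu : w ≤ u + a)
    (hwv : w ≤ v + b) :
    p / (p + u + v) ≤ a / (a + u + w) + b / (b + w + v) := by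
  calc p / (p + u + v) ≤ (a + b) / (a + b + u + v) := by
        rw [div_le_div_iff₀ (by positivity) (by positivity)]
        nlinarith [mul_le_mul_of_nonneg_right hpab (add_pos hu hv).le]
    _ = a / (a + b + u + v) + b / (a + b + u + v) := add_div _ _ _
    _ ≤ a / (a + u + w) + b / (b + w + v) :=
        add_le_add (div_le_div_of_nonneg_left ha (by positivity) (by linarith))
          (div_le_div_of_nonneg_left hb (by positivity) (by linarith))

theorem t_metric_is_metric {X : Type*} [MetricSpace X] (G : Set X)
    (hne : G.Nonempty) (hopen : IsOpen G) (hproper : G ≠ Set.univ)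
    (hfr : (frontier G).Nonempty) :
    let dG : X → ℝ := fun x => Metric.infDist x (frontier G)
    let t : X → X → ℝ := fun x y => dist x y / (dist x y + dG x + dG y)
    (∀ x ∈ G, ∀ y ∈ G, 0 ≤ t x y ∧ (t x y = 0 ↔ x = y)) ∧
    (∀ x ∈ G, ∀ y ∈ G, t x y = t y x) ∧
    (∀ x ∈ G, ∀ y ∈ G, ∀ z ∈ G, t x y ≤ t x z + t z y) := by
  intro dG t
  have hpos : ∀ x ∈ G, 0 < dG x := fun x hx => infDist_frontier_pos_of_isOpen hopen hfr hx
  refine ⟨fun x hx y hy => ?_, fun x _ y _ => ?_, fun x hx y hy z hz => ?_⟩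
  · have hx' := hpos x hx
    have hy' := hpos y hy
    have hden : 0 < dist x y + dG x + dG y := by positivity
    exact ⟨div_nonneg dist_nonneg hden.le, by simp only [t, div_eq_zero_iff, hden.ne', or_false, dist_eq_zero]⟩
  · simp only [t, dist_comm x y, add_right_comm]
  · refine div_add_add_le_div_add_div dist_nonneg dist_nonneg dist_nonneg (hpos x hx) (hpos y hy)
      (hpos z hz) (dist_triangle x z y) ?_ Metric.infDist_le_infDist_add_dist
    rw [dist_comm x z]
    exact Metric.infDist_le_infDist_add_dist
end

section
/- Let X be a metric space, G a nonempty subset of X, and c : G × G → [0,∞) a symmetric function such that c(x,z) ≤ dist(z,y) + c(x,y) for all x, y, z ∈ G. Define φ(x,x) = 0 and φ(x,y) = dist(x,y) / (dist(x,y) + c(x,y)) for x ≠ y. Then φ is a metric on G: φ(x,y) ≥ 0 with φ(x,y) = 0 iff x = y, φ(x,y) = φ(y,x), and φ(x,y) ≤ φ(x,z) + φ(z,y) for all x, y, z ∈ G. -/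
/-- A subadditivity property of `t ↦ t / (t + s)` under a compatible change of the parameter `s`. -/
theorem div_add_le_div_add_add_div_add {a b d p q r : ℝ} (ha : 0 ≤ a) (hb : 0 ≤ b) (hd : 0 < d)
    (hp : 0 ≤ p) (hq : 0 ≤ q) (hr : 0 ≤ r) (hdab : d ≤ a + b) (hpr : p ≤ b + r)
    (hqr : q ≤ a + r) : d / (d + r) ≤ a / (a + p) + b / (b + q) := by
  have div_le {t s u : ℝ} (ht : 0 ≤ t) (hs : 0 ≤ s) (hu : t + s ≤ u) :
      t / u ≤ t / (t + s) := by
    rcases ht.eq_or_lt with rfl | ht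
    · simp
    · exact div_le_div_of_nonneg_left ht.le (by linarith) hu
  calc d / (d + r) ≤ (a + b) / (a + b + r) := by
        rw [div_le_div_iff₀ (by linarith) (by linarith)]
        nlinarith
    _ = a / (a + b + r) + b / (a + b + r) := add_div _ _ _
    _ ≤ a / (a + p) + b / (b + q) :=
        add_le_add (div_le ha hp (by linarith)) (div_le hb hq (by linarith))

open Classical in

theorem phi_is_metric {X : Type*} [MetricSpace X] (G : Set X) (hne : G.Nonempty)
    (c : X → X → ℝ)
    (hc_nonneg : ∀ x ∈ G, ∀ y ∈ G, 0 ≤ c x y)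
    (hc_symm : ∀ x ∈ G, ∀ y ∈ G, c x y = c y x)
    (hc_ineq : ∀ x ∈ G, ∀ y ∈ G, ∀ z ∈ G, c x z ≤ dist z y + c x y) :
    let φ : X → X → ℝ := fun x y => if x = y then 0 else dist x y / (dist x y + c x y)
    (∀ x ∈ G, ∀ y ∈ G, 0 ≤ φ x y ∧ (φ x y = 0 ↔ x = y)) ∧
    (∀ x ∈ G, ∀ y ∈ G, φ x y = φ y x) ∧
    (∀ x ∈ G, ∀ y ∈ G, ∀ z ∈ G, φ x y ≤ φ x z + φ z y) := by
  intro φ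
  have hφ (x y : X) : φ x y = dist x y / (dist x y + c x y) := by
    by_cases h : x = y <;> simp [φ, h]
  simp only [hφ]
  refine ⟨fun x hx y hy => ⟨?_, ?_⟩, fun x hx y hy => ?_, fun x hx y hy z hz => ?_⟩
  · have := hc_nonneg x hx y hy
    positivity
  · have := hc_nonneg x hx y hy
    refine ⟨fun h => ?_, fun h => by simp [h]⟩
    by_contra hxy
    have := dist_pos.2 hxy
    have : 0 < dist x y / (dist x y + c x y) := by positivity
    exact this.ne' h
  · rw [dist_comm, hc_symm x hx y hy]
  · have hxy := hc_nonneg x hx y hy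
    have hxz := hc_nonneg x hx z hz
    have hzy := hc_nonneg z hz y hy
    rcases eq_or_ne x y with rfl | hne'
    · simp only [dist_self, zero_div]
      positivity
    · refine div_add_le_div_add_add_div_add dist_nonneg dist_nonneg (dist_pos.2 hne') hxz hzy hxy
        (dist_triangle x z y) (hc_ineq x hx y hy z hz) ?_
      rw [hc_symm z hz y hy, hc_symm x hx y hy, dist_comm x z]
      exact hc_ineq y hy x hx z hz
end

section
/- Let 0 < c ≤ 1 be a constant and let 𝔹^n be the open unit ball of ℝ^n. Define ψ(x,x) = 0 and ψ(x,y) = |x−y| / (|x−y| + c·|x|·|y|) for x ≠ y, where |·| is the Euclidean norm. Then ψ is a metric on 𝔹^n: ψ(x,y) ≥ 0 with ψ(x,y) = 0 iff x = y, ψ(x,y) = ψ(y,x), and ψ(x,y) ≤ ψ(x,z) + ψ(z,y) for all x, y, z ∈ 𝔹^n. -/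
theorem div_add_le_div_add_add_div_add_s2 {c s t u : ℝ} (hc : 0 < c) (hs : 0 ≤ s) (ht : 0 ≤ t)
    (hu : 0 ≤ u) (h : s ≤ t + u) : s / (s + c) ≤ t / (t + c) + u / (u + c) :=
  calc
    s / (s + c) ≤ (t + u) / (t + u + c) := by
      rw [div_le_div_iff₀ (by positivity) (by positivity)]
      nlinarith
    _ = t / (t + u + c) + u / (t + u + c) := add_div _ _ _
    _ ≤ t / (t + c) + u / (u + c) := by
      gcongr <;> linarith

theorem div_add_mul_mul_le_of_mul_le {c p q r a b e : ℝ} (hc : 0 < c) (hp : 0 < p) (hq : 0 < q)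
    (hr : 0 < r) (ha : 0 ≤ a) (hb : 0 ≤ b) (he : 0 ≤ e) (h : p * e ≤ q * b + r * a) :
    p / (p + c * a * b) ≤ q / (q + c * a * e) + r / (r + c * e * b) := by
  have hp1 : p / (p + c * a * b) ≤ 1 := div_le_one_of_le₀ (by
    have : 0 ≤ c * a * b := by positivity
    linarith) (by positivity)
  have hq0 : 0 ≤ q / (q + c * a * e) := by positivity
  have hr0 : 0 ≤ r / (r + c * e * b) := by positivity
  rcases ha.eq_or_lt with rfl | ha
  · have : q / (q + c * 0 * e) = 1 := by simp [hq.ne']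
    linarith
  rcases hb.eq_or_lt with rfl | hb
  · have : r / (r + c * e * 0) = 1 := by simp [hr.ne']
    linarith
  rcases he.eq_or_lt with rfl | he
  · have : q / (q + c * a * 0) = 1 := by simp [hq.ne']
    linarith
  have key : ∀ {d u v : ℝ}, 0 < d → 0 < u → 0 < v →
      d / (d + c * u * v) = d / (u * v) / (d / (u * v) + c) := by
    intro d u v hd hu hv
    field_simp
  rw [key hp ha hb, key hq ha he, key hr he hb]
  refine div_add_le_div_add_add_div_add_s2 hc (by positivity) (by positivity) (by positivity) ?_
  rw [show q / (a * e) + r / (e * b) = (q * b + r * a) / (a * b * e) by field_simp,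
    show p / (a * b) = p * e / (a * b * e) by field_simp]
  gcongr

open Classical in

theorem psi_is_metric (n : ℕ) (c : ℝ) (hc0 : 0 < c) (hc1 : c ≤ 1) :
    let B : Set (EuclideanSpace ℝ (Fin n)) := {x | ‖x‖ < 1}
    let ψ : EuclideanSpace ℝ (Fin n) → EuclideanSpace ℝ (Fin n) → ℝ :=
      fun x y => if x = y then 0 else dist x y / (dist x y + c * ‖x‖ * ‖y‖)
    (∀ x ∈ B, ∀ y ∈ B, 0 ≤ ψ x y ∧ (ψ x y = 0 ↔ x = y)) ∧
    (∀ x ∈ B, ∀ y ∈ B, ψ x y = ψ y x) ∧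
    (∀ x ∈ B, ∀ y ∈ B, ∀ z ∈ B, ψ x y ≤ ψ x z + ψ z y) := by
  intro B ψ
  have hnn : ∀ x y, 0 ≤ ψ x y := by
    intro x y
    dsimp only [ψ]
    split_ifs <;> positivity
  refine ⟨fun x _ y _ ↦ ⟨hnn x y, ?_, ?_⟩, fun x _ y _ ↦ ?_, fun x _ y _ z _ ↦ ?_⟩
  · intro h
    by_contra hxy
    have hd : 0 < dist x y := dist_pos.2 hxy
    have : 0 < dist x y / (dist x y + c * ‖x‖ * ‖y‖) := by positivity
    simp only [ψ, if_neg hxy] at h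
    exact this.ne' h
  · rintro rfl
    simp [ψ]
  · simp only [ψ, eq_comm (a := x), dist_comm x, mul_right_comm c ‖x‖]
  · by_cases hxy : x = y
    · have : ψ x y = 0 := if_pos hxy
      linarith [hnn x z, hnn z y]
    by_cases hxz : x = z
    · subst hxz
      linarith [hnn x x]
    by_cases hzy : z = y
    · subst hzy
      linarith [hnn z z]
    simp only [ψ, if_neg hxy, if_neg hxz, if_neg hzy]
    refine div_add_mul_mul_le_of_mul_le hc0 (dist_pos.2 hxy) (dist_pos.2 hxz) (dist_pos.2 hzy)
      (norm_nonneg _) (norm_nonneg _) (norm_nonneg _) ?_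
    simpa using EuclideanGeometry.mul_dist_le_mul_dist_add_mul_dist x z y 0
end

section
/- Let 0 < c ≤ √2 be a constant and let 𝔹^n be the open unit ball of ℝ^n. The function χ(x,y) = |x−y| / (|x−y| + c·√((2−|x|)(2−|y|))) is a metric on 𝔹^n: χ(x,y) ≥ 0 with χ(x,y) = 0 iff x = y, χ(x,y) = χ(y,x), and χ(x,y) ≤ χ(x,z) + χ(z,y) for all x, y, z ∈ 𝔹^n. -/
/-- If `1 ≤ Q` and `0 ≤ R ≤ √2`, then `R (R - Q)` is at most `d √2 / 2` for every nonnegative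
upper bound `d` of `R ^ 2 - Q ^ 2`. -/
lemma mul_sub_le_of_sq_sub_sq_le {Q R d : ℝ} (hQ : 1 ≤ Q) (hR : 0 ≤ R) (hR2 : R ≤ Real.sqrt 2)
    (hd0 : 0 ≤ d) (hd : R ^ 2 - Q ^ 2 ≤ d) : R * (R - Q) ≤ d * (Real.sqrt 2 / 2) := by
  have hs : Real.sqrt 2 ^ 2 = 2 := Real.sq_sqrt (by norm_num)
  have hs1 : 1 ≤ Real.sqrt 2 := Real.one_le_sqrt.2 (by norm_num)
  set s := Real.sqrt 2
  rcases le_total R Q with h | h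
  · have h1 : R * (R - Q) ≤ 0 := mul_nonpos_of_nonneg_of_nonpos hR (by linarith)
    have h2 : 0 ≤ d * (s / 2) := by positivity
    linarith
  · have h1 : R * s ≤ R + Q := by nlinarith
    have h2 : R ≤ (R + Q) * (s / 2) := by nlinarith
    calc R * (R - Q) ≤ (R + Q) * (s / 2) * (R - Q) :=
          mul_le_mul_of_nonneg_right h2 (by linarith)
      _ = (R ^ 2 - Q ^ 2) * (s / 2) := by ring
      _ ≤ d * (s / 2) := mul_le_mul_of_nonneg_right hd (by linarith)

lemma div_add_le_div_add_add_div_add_s4 {c P Q R a b d : ℝ} (hc0 : 0 < c) (hc2 : c ≤ Real.sqrt 2)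
    (hP : 1 ≤ P) (hQ : 1 ≤ Q) (hR : 1 ≤ R) (hR2 : R ≤ Real.sqrt 2)
    (ha : 0 ≤ a) (hb : 0 ≤ b) (hd : 0 ≤ d) (habd : a ≤ b + d)
    (hbP : R ^ 2 - P ^ 2 ≤ b) (hdQ : R ^ 2 - Q ^ 2 ≤ d) :
    a / (a + c * (P * Q)) ≤ b / (b + c * (P * R)) + d / (d + c * (R * Q)) := by
  have hs : Real.sqrt 2 * Real.sqrt 2 = 2 := Real.mul_self_sqrt (by norm_num)
  have hs0 : 0 ≤ Real.sqrt 2 := Real.sqrt_nonneg 2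
  have h1 := mul_le_mul_of_nonneg_left
    (mul_sub_le_of_sq_sub_sq_le hQ (by linarith) hR2 hd hdQ) hb
  have h2 := mul_le_mul_of_nonneg_left
    (mul_sub_le_of_sq_sub_sq_le hP (by linarith) hR2 hb hbP) hd
  have hcs : c * Real.sqrt 2 ≤ 2 :=
    (mul_le_mul_of_nonneg_right hc2 hs0).trans_eq hs
  have h3 := mul_le_mul_of_nonneg_right habd (sq_nonneg R)
  have h4 : a * R ^ 2 - R * (b * Q + d * P) ≤ Real.sqrt 2 * (b * d) := by linarith
  have h5 := mul_le_mul_of_nonneg_left h4 hc0.le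
  have h6 := mul_le_mul_of_nonneg_right hcs (mul_nonneg hb hd)
  have h7 : 0 ≤ 2 * (b * d) + c * (R * (b * Q + d * P)) - c * (a * R ^ 2) := by linarith
  have hP0 : 0 < P := by linarith
  have hQ0 : 0 < Q := by linarith
  have hR0 : 0 < R := by linarith
  have h8 := mul_nonneg (by positivity : 0 ≤ c * (P * Q)) h7
  have h9 : 0 ≤ a * (b * d) := by positivity
  rw [div_add_div _ _ (by positivity) (by positivity), div_le_div_iff₀ (by positivity)
    (by positivity)]
  linarith

theorem chi_is_metric (n : ℕ) (c : ℝ) (hc0 : 0 < c) (hc2 : c ≤ Real.sqrt 2) :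
    let B : Set (EuclideanSpace ℝ (Fin n)) := {x | ‖x‖ < 1}
    let χ : EuclideanSpace ℝ (Fin n) → EuclideanSpace ℝ (Fin n) → ℝ :=
      fun x y => dist x y / (dist x y + c * Real.sqrt ((2 - ‖x‖) * (2 - ‖y‖)))
    (∀ x ∈ B, ∀ y ∈ B, 0 ≤ χ x y ∧ (χ x y = 0 ↔ x = y)) ∧
    (∀ x ∈ B, ∀ y ∈ B, χ x y = χ y x) ∧
    (∀ x ∈ B, ∀ y ∈ B, ∀ z ∈ B, χ x y ≤ χ x z + χ z y) := by
  intro B χ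
  refine ⟨fun x hx y hy => ⟨by positivity, ?_⟩, fun x _ y _ => ?_, fun x hx y hy z hz => ?_⟩
  · have hx' : ‖x‖ < 1 := hx
    have hy' : ‖y‖ < 1 := hy
    have hpos : 0 < Real.sqrt ((2 - ‖x‖) * (2 - ‖y‖)) :=
      Real.sqrt_pos.2 (mul_pos (by linarith) (by linarith))
    have hden : dist x y + c * Real.sqrt ((2 - ‖x‖) * (2 - ‖y‖)) ≠ 0 := by positivity
    simp only [χ, div_eq_zero_iff, hden, or_false, dist_eq_zero]
  · simp only [χ, dist_comm x y, mul_comm (2 - ‖x‖)]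
  · have hx' : ‖x‖ < 1 := hx
    have hy' : ‖y‖ < 1 := hy
    have hz' : ‖z‖ < 1 := hz
    have hx0 : 0 ≤ 2 - ‖x‖ := by linarith
    have hy0 : 0 ≤ 2 - ‖y‖ := by linarith
    have hz0 : 0 ≤ 2 - ‖z‖ := by linarith
    simp only [χ, Real.sqrt_mul hx0, Real.sqrt_mul hz0]
    refine div_add_le_div_add_add_div_add_s4 hc0 hc2 (Real.one_le_sqrt.2 (by linarith))
      (Real.one_le_sqrt.2 (by linarith)) (Real.one_le_sqrt.2 (by linarith))
      (Real.sqrt_le_sqrt (by linarith [norm_nonneg z])) dist_nonneg dist_nonneg dist_nonneg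
      (dist_triangle x z y) ?_ ?_
    · rw [Real.sq_sqrt hx0, Real.sq_sqrt hz0, dist_eq_norm]
      linarith [norm_sub_norm_le x z]
    · rw [Real.sq_sqrt hy0, Real.sq_sqrt hz0, dist_comm, dist_eq_norm]
      linarith [norm_sub_norm_le y z]
end

section
/- For every domain G ⊊ ℝ^n and all points x, y ∈ G, the inequalities j*_G(x,y)/2 ≤ t_G(x,y) ≤ j*_G(x,y) hold. -/
noncomputable def tMetric {n : ℕ} (G : Set (EuclideanSpace ℝ (Fin n)))
    (x y : EuclideanSpace ℝ (Fin n)) : ℝ :=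
  dist x y / (dist x y + Metric.infDist x (frontier G) + Metric.infDist y (frontier G))

noncomputable def jStarMetric {n : ℕ} (G : Set (EuclideanSpace ℝ (Fin n)))
    (x y : EuclideanSpace ℝ (Fin n)) : ℝ :=
  dist x y / (dist x y + 2 * min (Metric.infDist x (frontier G)) (Metric.infDist y (frontier G)))

theorem t_jstar_bounds {n : ℕ} (G : Set (EuclideanSpace ℝ (Fin n)))
    (hne : G.Nonempty) (hopen : IsOpen G) (hconn : IsConnected G) (hproper : G ≠ Set.univ)
    (x y : EuclideanSpace ℝ (Fin n)) (hx : x ∈ G) (hy : y ∈ G) :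
    jStarMetric G x y / 2 ≤ tMetric G x y ∧ tMetric G x y ≤ jStarMetric G x y := by
  have hxy := Metric.infDist_le_infDist_add_dist (s := frontier G) (x := x) (y := y)
  have hyx := Metric.infDist_le_infDist_add_dist (s := frontier G) (x := y) (y := x)
  rw [dist_comm y x] at hyx
  have ha : 0 ≤ Metric.infDist x (frontier G) := Metric.infDist_nonneg
  have hb : 0 ≤ Metric.infDist y (frontier G) := Metric.infDist_nonneg
  unfold jStarMetric tMetric
  rcases (dist_nonneg (x := x) (y := y)).eq_or_lt with hd | hd
  · simp [← hd]
  · rw [div_div]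
    constructor <;> apply div_le_div_of_nonneg_left hd.le (by positivity) <;>
      rcases min_cases (Metric.infDist x (frontier G)) (Metric.infDist y (frontier G)) with
        ⟨h, _⟩ | ⟨h, _⟩ <;> rw [h] <;> linarith
end

section
/- For every domain G ⊊ ℝ^n and all points x, y ∈ G, the inequalities p_G(x,y)/2 ≤ t_G(x,y) ≤ p_G(x,y) hold. -/
noncomputable def pointPairFunction {n : ℕ} (G : Set (EuclideanSpace ℝ (Fin n)))
    (x y : EuclideanSpace ℝ (Fin n)) : ℝ :=
  dist x y / Real.sqrt ((dist x y) ^ 2 + 4 * Metric.infDist x (frontier G) * Metric.infDist y (frontier G))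

/-- If `0 ≤ a, b`, `0 < s` and `|a - b| ≤ s`, then the quotients `s / (s + a + b)` and
`s / √(s ^ 2 + 4 * a * b)` are comparable. -/
theorem div_sqrt_half_le_and_le {s a b : ℝ} (hs : 0 < s) (ha : 0 ≤ a) (hb : 0 ≤ b)
    (hab : |a - b| ≤ s) :
    s / √(s ^ 2 + 4 * a * b) / 2 ≤ s / (s + a + b) ∧
      s / (s + a + b) ≤ s / √(s ^ 2 + 4 * a * b) := by
  have hprod : 0 ≤ a * b := mul_nonneg ha hb
  have hpos : 0 < s ^ 2 + 4 * a * b := by nlinarith [pow_pos hs 2]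
  have hsqrt : 0 < √(s ^ 2 + 4 * a * b) := Real.sqrt_pos.2 hpos
  have hdiff : (a - b) ^ 2 ≤ s ^ 2 := sq_le_sq' (abs_le.1 hab).1 (abs_le.1 hab).2
  constructor
  · rw [div_div]
    refine div_le_div_of_nonneg_left hs.le (by positivity) ?_
    refine (sq_le_sq₀ (by positivity) (by positivity)).1 ?_
    rw [mul_pow, Real.sq_sqrt hpos.le]
    nlinarith [sq_nonneg (s - (a + b))]
  · refine div_le_div_of_nonneg_left hs.le hsqrt ?_
    rw [Real.sqrt_le_left (by positivity)]
    nlinarith [sq_nonneg (a - b), mul_nonneg hs.le ha, mul_nonneg hs.le hb]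

theorem t_p_bounds {n : ℕ} (G : Set (EuclideanSpace ℝ (Fin n)))
    (hne : G.Nonempty) (hopen : IsOpen G) (hconn : IsConnected G) (hproper : G ≠ Set.univ)
    (x y : EuclideanSpace ℝ (Fin n)) (hx : x ∈ G) (hy : y ∈ G) :
    pointPairFunction G x y / 2 ≤ tMetric G x y ∧ tMetric G x y ≤ pointPairFunction G x y := by
  rcases (dist_nonneg (x := x) (y := y)).eq_or_lt with h | h
  · simp [pointPairFunction, tMetric, ← h]
  · refine div_sqrt_half_le_and_le h Metric.infDist_nonneg Metric.infDist_nonneg ?_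
    rw [abs_sub_le_iff, sub_le_iff_le_add', sub_le_iff_le_add']
    exact ⟨Metric.infDist_le_infDist_add_dist,
      dist_comm x y ▸ Metric.infDist_le_infDist_add_dist⟩
end

section
/- For every domain G ⊊ ℝ^n and all points x, y ∈ G, the inequalities s_G(x,y)/2 ≤ t_G(x,y) ≤ s_G(x,y) hold. -/
noncomputable def sMetric {n : ℕ} (G : Set (EuclideanSpace ℝ (Fin n)))
    (x y : EuclideanSpace ℝ (Fin n)) : ℝ :=
  dist x y / sInf ((fun z => dist x z + dist z y) '' frontier G)

theorem t_s_bounds {n : ℕ} (G : Set (EuclideanSpace ℝ (Fin n)))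
    (hne : G.Nonempty) (hopen : IsOpen G) (hconn : IsConnected G) (hproper : G ≠ Set.univ)
    (x y : EuclideanSpace ℝ (Fin n)) (hx : x ∈ G) (hy : y ∈ G) :
    sMetric G x y / 2 ≤ tMetric G x y ∧ tMetric G x y ≤ sMetric G x y := by
  have hF : (frontier G).Nonempty := nonempty_frontier_iff.2 ⟨hne, hproper⟩
  have infDist_pos : ∀ p ∈ G, 0 < Metric.infDist p (frontier G) := fun p hp =>
    (isClosed_frontier.notMem_iff_infDist_pos hF).1 fun h =>
      Set.disjoint_left.1 (disjoint_frontier_iff_isOpen.2 hopen) h hp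
  have ha := infDist_pos x hx
  have hb := infDist_pos y hy
  have hI : ∀ z ∈ frontier G,
      sInf ((fun z => dist x z + dist z y) '' frontier G) ≤ dist x z + dist z y := fun z hz =>
    csInf_le ⟨0, by rintro _ ⟨w, -, rfl⟩; positivity⟩ ⟨z, hz, rfl⟩
  have hI_ge : ∀ c, (∀ z ∈ frontier G, c ≤ dist x z + dist z y) →
      c ≤ sInf ((fun z => dist x z + dist z y) '' frontier G) := fun c hc =>
    le_csInf (hF.image _) (by rintro _ ⟨z, hz, rfl⟩; exact hc z hz)
  unfold sMetric tMetric
  generalize sInf ((fun z => dist x z + dist z y) '' frontier G) = I at *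
  have h_dist : dist x y ≤ I := hI_ge _ fun z _ => dist_triangle x z y
  have h_sum : Metric.infDist x (frontier G) + Metric.infDist y (frontier G) ≤ I :=
    hI_ge _ fun z hz => add_le_add (Metric.infDist_le_dist_of_mem hz)
      (dist_comm z y ▸ Metric.infDist_le_dist_of_mem hz)
  have h_left : (I - dist x y) / 2 ≤ Metric.infDist x (frontier G) :=
    (Metric.le_infDist hF).2 fun z hz => by
      linarith [hI z hz, dist_triangle_left z y x]
  have h_right : (I - dist x y) / 2 ≤ Metric.infDist y (frontier G) :=
    (Metric.le_infDist hF).2 fun z hz => by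
      linarith [hI z hz, dist_triangle_right x z y, dist_comm z y]
  have hD : 0 ≤ dist x y := dist_nonneg
  constructor
  · rw [div_div]
    exact div_le_div_of_nonneg_left hD (by linarith) (by linarith)
  · exact div_le_div_of_nonneg_left hD (by linarith) (by linarith)
end

section
/- For every fixed domain G ⊊ ℝ^n the bounds of the inequalities t vs. j*, p, s are sharp: for every k ∈ (0,1) there exist distinct points x, y ∈ G with j*_G(x,y) = p_G(x,y) = s_G(x,y) = (1−k)/(1+k) and t_G(x,y) = (1−k)/2; consequently, for every ε > 0 there are distinct x, y ∈ G with t_G(x,y)/j*_G(x,y) < 1/2 + ε and distinct x', y' ∈ G with t_G(x',y')/j*_G(x',y') > 1 − ε. -/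
/-- Points of the segment from `x` to a nearest frontier point of an open set `G` lie in `G`, and
their distances to `x` and to the frontier are proportional to the distance from `x` to the
frontier. -/
lemma exists_mem_infDist_frontier_eq {E : Type*} [NormedAddCommGroup E] [NormedSpace ℝ E]
    [ProperSpace E] {G : Set E} (hopen : IsOpen G) (hproper : G ≠ Set.univ) {x : E} (hx : x ∈ G)
    {k : ℝ} (hk : 0 < k) (hk1 : k < 1) :
    ∃ d > 0, ∃ y ∈ G, ∃ z ∈ frontier G,
      Metric.infDist x (frontier G) = d ∧ Metric.infDist y (frontier G) = k * d ∧
      dist x z = d ∧ dist z y = k * d ∧ dist x y = (1 - k) * d := by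
  have hF : (frontier G).Nonempty := nonempty_frontier_iff.2 ⟨⟨x, hx⟩, hproper⟩
  obtain ⟨z, hz, hd⟩ := isClosed_frontier.exists_infDist_eq_dist hF x
  have hxF : x ∉ frontier G := fun h => by
    rw [hopen.frontier_eq] at h
    exact h.2 hx
  have hpos : 0 < dist x z := dist_pos.2 fun h => hxF (h ▸ hz)
  have hzy : dist z (AffineMap.lineMap z x k) = k * dist x z := by
    rw [dist_left_lineMap, Real.norm_of_nonneg hk.le, dist_comm]
  have hxy : dist x (AffineMap.lineMap z x k) = (1 - k) * dist x z := by
    rw [dist_right_lineMap, Real.norm_of_nonneg (by linarith), dist_comm z x]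
  refine ⟨dist x z, hpos, AffineMap.lineMap z x k, ?_, z, hz, hd, le_antisymm ?_ ?_, rfl, hzy, hxy⟩
  · refine (convex_ball x (dist x z)).isPreconnected.subset_of_closure_inter_subset hopen
      ⟨x, Metric.mem_ball_self hpos, hx⟩ ?_ (by rw [Metric.mem_ball, dist_comm, hxy]; nlinarith)
    rintro w ⟨hwG, hw⟩
    by_contra hwn
    have hwF : w ∈ frontier G := hopen.frontier_eq ▸ ⟨hwG, hwn⟩
    have := Metric.infDist_le_dist_of_mem (x := x) hwF
    rw [Metric.mem_ball, dist_comm] at hw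
    linarith
  · rw [← hzy, dist_comm]
    exact Metric.infDist_le_dist_of_mem hz
  · have := Metric.infDist_le_infDist_add_dist (s := frontier G) (x := x)
      (y := AffineMap.lineMap z x k)
    rw [hxy, hd] at this
    linarith

/-- Pairs of points realizing the prescribed values of all four functions simultaneously. -/
lemma exists_metrics_eq {n : ℕ} {G : Set (EuclideanSpace ℝ (Fin n))}
    (hne : G.Nonempty) (hopen : IsOpen G) (hproper : G ≠ Set.univ)
    {k : ℝ} (hk : 0 < k) (hk1 : k < 1) :
    ∃ x ∈ G, ∃ y ∈ G, x ≠ y ∧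
      jStarMetric G x y = (1 - k) / (1 + k) ∧
      pointPairFunction G x y = (1 - k) / (1 + k) ∧
      sMetric G x y = (1 - k) / (1 + k) ∧
      tMetric G x y = (1 - k) / 2 := by
  obtain ⟨x, hx⟩ := hne
  obtain ⟨d, hd, y, hy, z, hz, hdx, hdy, hxz, hzy, hxy⟩ :=
    exists_mem_infDist_frontier_eq hopen hproper hx hk hk1
  refine ⟨x, hx, y, hy, dist_pos.1 (hxy ▸ mul_pos (by linarith) hd), ?_, ?_, ?_, ?_⟩
  · rw [jStarMetric, hdx, hdy, hxy, min_eq_right (by nlinarith),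
      show (1 - k) * d + 2 * (k * d) = (1 + k) * d by ring, mul_div_mul_right _ _ hd.ne']
  · rw [pointPairFunction, hdx, hdy, hxy,
      show ((1 - k) * d) ^ 2 + 4 * d * (k * d) = ((1 + k) * d) ^ 2 by ring,
      Real.sqrt_sq (by positivity), mul_div_mul_right _ _ hd.ne']
  · have hleast : IsLeast ((fun w => dist x w + dist w y) '' frontier G) ((1 + k) * d) := by
      refine ⟨⟨z, hz, by simp only [hxz, hzy]; ring⟩, ?_⟩
      rintro _ ⟨w, hw, rfl⟩
      have h₁ := Metric.infDist_le_dist_of_mem (x := x) hw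
      have h₂ := Metric.infDist_le_dist_of_mem (x := y) hw
      rw [dist_comm y w] at h₂
      simp only
      linarith
    rw [sMetric, hleast.csInf_eq, hxy, mul_div_mul_right _ _ hd.ne']
  · rw [tMetric, hdx, hdy, hxy, show (1 - k) * d + d + k * d = 2 * d by ring,
      mul_div_mul_right _ _ hd.ne']

theorem t_bounds_sharp {n : ℕ} (G : Set (EuclideanSpace ℝ (Fin n)))
    (hne : G.Nonempty) (hopen : IsOpen G) (hconn : IsConnected G) (hproper : G ≠ Set.univ) :
    (∀ k : ℝ, 0 < k → k < 1 → ∃ x ∈ G, ∃ y ∈ G, x ≠ y ∧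
      jStarMetric G x y = (1 - k) / (1 + k) ∧
      pointPairFunction G x y = (1 - k) / (1 + k) ∧
      sMetric G x y = (1 - k) / (1 + k) ∧
      tMetric G x y = (1 - k) / 2) ∧
    (∀ ε : ℝ, 0 < ε →
      (∃ x ∈ G, ∃ y ∈ G, x ≠ y ∧ tMetric G x y / jStarMetric G x y < 1 / 2 + ε) ∧
      (∃ x ∈ G, ∃ y ∈ G, x ≠ y ∧ tMetric G x y / jStarMetric G x y > 1 - ε)) := by
  have hratio : ∀ k : ℝ, 0 < k → k < 1 → ∃ x ∈ G, ∃ y ∈ G, x ≠ y ∧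
      tMetric G x y / jStarMetric G x y = (1 + k) / 2 := fun k hk hk1 => by
    obtain ⟨x, hx, y, hy, hxy, hj, -, -, ht⟩ := exists_metrics_eq hne hopen hproper hk hk1
    refine ⟨x, hx, y, hy, hxy, ?_⟩
    have h₁ : 1 - k ≠ 0 := by linarith
    have h₂ : 1 + k ≠ 0 := by linarith
    rw [ht, hj]
    field_simp
  refine ⟨fun k hk hk1 => exists_metrics_eq hne hopen hproper hk hk1, fun ε hε => ⟨?_, ?_⟩⟩
  · obtain ⟨x, hx, y, hy, hxy, h⟩ := hratio (min ε (1 / 2)) (by positivity)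
      ((min_le_right _ _).trans_lt (by norm_num))
    refine ⟨x, hx, y, hy, hxy, ?_⟩
    rw [h]
    linarith [min_le_left ε (1 / 2)]
  · obtain ⟨x, hx, y, hy, hxy, h⟩ := hratio (max (1 - ε) (1 / 2))
      (lt_max_of_lt_right (by norm_num)) (max_lt (by linarith) (by norm_num))
    refine ⟨x, hx, y, hy, hxy, ?_⟩
    rw [h]
    linarith [le_max_left (1 - ε) (1 / 2)]
end

section
/- Let G ⊊ ℝ^n be a domain, x ∈ G and r > 0. For each of the metrics η_G ∈ {j*_G, p_G, s_G}, the ball B_η(x,r) = {y ∈ G : η_G(x,y) < r} touches the boundary of G, in the sense that the Euclidean closure of B_η(x,r) intersects ∂G, if and only if r ≥ 1. -/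
theorem infDist_frontier_pos {E : Type*} [PseudoMetricSpace E] {G : Set E} (hG : IsOpen G)
    (hF : (frontier G).Nonempty) {x : E} (hx : x ∈ G) : 0 < Metric.infDist x (frontier G) :=
  (isClosed_frontier.notMem_iff_infDist_pos hF).1 fun h =>
    Set.disjoint_left.1 (disjoint_frontier_iff_isOpen.2 hG) h hx

theorem ball_infDist_frontier_subset {E : Type*} [NormedAddCommGroup E] [NormedSpace ℝ E]
    {G : Set E} (hG : IsOpen G) {x : E} (hx : x ∈ G) :
    Metric.ball x (Metric.infDist x (frontier G)) ⊆ G := by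
  rcases (Metric.infDist_nonneg (x := x) (s := frontier G)).eq_or_lt with h | h
  · simp [← h]
  have hsub : Metric.ball x (Metric.infDist x (frontier G)) ⊆ G ∪ interior Gᶜ := by
    have hcompl := compl_frontier_eq_union_interior (s := G)
    rw [hG.interior_eq] at hcompl
    exact hcompl ▸ Metric.disjoint_ball_infDist.subset_compl_right
  exact (convex_ball x _).isPreconnected.subset_left_of_subset_union hG isOpen_interior
    (disjoint_compl_right.mono_right interior_subset) hsub
    ⟨x, Metric.mem_ball_self h, hx⟩

theorem closure_inter_frontier_nonempty {E : Type*} [NormedAddCommGroup E] [NormedSpace ℝ E]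
    [ProperSpace E] {G A : Set E} {x : E} (hF : (frontier G).Nonempty)
    (hx : 0 < Metric.infDist x (frontier G))
    (hA : Metric.ball x (Metric.infDist x (frontier G)) ⊆ A) :
    (closure A ∩ frontier G).Nonempty := by
  obtain ⟨z, hz, hxz⟩ := isClosed_frontier.exists_infDist_eq_dist hF x
  refine ⟨z, closure_mono hA ?_, hz⟩
  rw [closure_ball x hx.ne', Metric.mem_closedBall', hxz]

theorem le_of_mem_closure_of_continuousAt {X : Type*} [TopologicalSpace X] {G : Set X}
    {f : X → ℝ} {z : X} {r : ℝ} (hz : z ∈ closure {y | y ∈ G ∧ f y < r})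
    (hf : ContinuousAt f z) : f z ≤ r :=
  hf.continuousWithinAt.closure_le hz continuousWithinAt_const fun _ hy => hy.2.le

section

variable {n : ℕ} {G : Set (EuclideanSpace ℝ (Fin n))} {x y z : EuclideanSpace ℝ (Fin n)}

theorem jStarMetric_lt_one (hx : 0 < Metric.infDist x (frontier G))
    (hy : 0 < Metric.infDist y (frontier G)) : jStarMetric G x y < 1 := by
  have hmin := lt_min hx hy
  have hxy := dist_nonneg (x := x) (y := y)
  rw [jStarMetric, div_lt_one (by linarith)]
  linarith

theorem pointPairFunction_lt_one (hx : 0 < Metric.infDist x (frontier G))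
    (hy : 0 < Metric.infDist y (frontier G)) : pointPairFunction G x y < 1 := by
  have hxy := dist_nonneg (x := x) (y := y)
  have hmul : 0 < 4 * Metric.infDist x (frontier G) * Metric.infDist y (frontier G) := by
    positivity
  rw [pointPairFunction, div_lt_one (Real.sqrt_pos.2 (by positivity))]
  exact Real.lt_sqrt_of_sq_lt (by linarith)

theorem infDist_add_infDist_le_sInf (hF : (frontier G).Nonempty) :
    Metric.infDist x (frontier G) + Metric.infDist y (frontier G) ≤
      sInf ((fun z => dist x z + dist z y) '' frontier G) := by
  refine le_csInf (hF.image _) ?_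
  rintro _ ⟨z, hz, rfl⟩
  have hyz := Metric.infDist_le_dist_of_mem (x := y) hz
  rw [dist_comm] at hyz
  exact add_le_add (Metric.infDist_le_dist_of_mem hz) hyz

theorem sInf_dist_add_dist_le (hz : z ∈ frontier G) :
    sInf ((fun z => dist x z + dist z y) '' frontier G) ≤ dist x z + dist z y := by
  refine csInf_le ⟨0, ?_⟩ ⟨z, hz, rfl⟩
  rintro _ ⟨w, -, rfl⟩
  positivity

theorem sMetric_lt_one (hF : (frontier G).Nonempty)
    (hxy : dist x y < Metric.infDist x (frontier G)) : sMetric G x y < 1 := by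
  have hle := infDist_add_infDist_le_sInf (x := x) (y := y) hF
  have hd := dist_nonneg (x := x) (y := y)
  have hy := Metric.infDist_nonneg (x := y) (s := frontier G)
  rw [sMetric, div_lt_one (by linarith)]
  linarith

theorem continuousAt_jStarMetric (hxz : x ≠ z) : ContinuousAt (jStarMetric G x) z := by
  have hd := dist_pos.2 hxz
  have hmin := le_min (Metric.infDist_nonneg (x := x) (s := frontier G))
    (Metric.infDist_nonneg (x := z) (s := frontier G))
  have hF := Metric.continuous_infDist_pt (frontier G)
  unfold jStarMetric
  exact ContinuousAt.div (by fun_prop) (by fun_prop) (by linarith)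

theorem continuousAt_pointPairFunction (hxz : x ≠ z) :
    ContinuousAt (pointPairFunction G x) z := by
  have hd := dist_pos.2 hxz
  have hx := Metric.infDist_nonneg (x := x) (s := frontier G)
  have hz := Metric.infDist_nonneg (x := z) (s := frontier G)
  have hF := Metric.continuous_infDist_pt (frontier G)
  unfold pointPairFunction
  exact ContinuousAt.div (by fun_prop) (by fun_prop) (Real.sqrt_pos.2 (by positivity)).ne'

theorem jStarMetric_of_mem_frontier (hxz : x ≠ z) (hz : z ∈ frontier G) :
    jStarMetric G x z = 1 := by
  rw [jStarMetric, Metric.infDist_zero_of_mem hz, min_eq_right Metric.infDist_nonneg, mul_zero,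
    add_zero, div_self (dist_pos.2 hxz).ne']

theorem pointPairFunction_of_mem_frontier (hxz : x ≠ z) (hz : z ∈ frontier G) :
    pointPairFunction G x z = 1 := by
  rw [pointPairFunction, Metric.infDist_zero_of_mem hz, mul_zero, add_zero,
    Real.sqrt_sq dist_nonneg, div_self (dist_pos.2 hxz).ne']

theorem one_le_of_mem_closure_sMetric_lt {r : ℝ} (hr : 0 < r)
    (hx : 0 < Metric.infDist x (frontier G)) (hxz : x ≠ z) (hz : z ∈ frontier G)
    (hcl : z ∈ closure {y | y ∈ G ∧ sMetric G x y < r}) : 1 ≤ r := by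
  have hsub : {y | y ∈ G ∧ sMetric G x y < r} ⊆ {y | dist x y ≤ r * (dist x z + dist z y)} := by
    rintro y ⟨-, hy⟩
    have hle := infDist_add_infDist_le_sInf (x := x) (y := y) ⟨z, hz⟩
    have hy0 := Metric.infDist_nonneg (x := y) (s := frontier G)
    rw [sMetric, div_lt_iff₀ (by linarith)] at hy
    exact hy.le.trans (mul_le_mul_of_nonneg_left (sInf_dist_add_dist_le hz) hr.le)
  have hmem : dist x z ≤ r * (dist x z + dist z z) :=
    closure_minimal hsub (isClosed_le (by fun_prop) (by fun_prop)) hcl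
  rw [dist_self, add_zero] at hmem
  exact (le_mul_iff_one_le_left (dist_pos.2 hxz)).1 hmem

end

theorem jps_balls_touch_boundary_iff {n : ℕ} (G : Set (EuclideanSpace ℝ (Fin n)))
    (hne : G.Nonempty) (hopen : IsOpen G) (hconn : IsConnected G) (hproper : G ≠ Set.univ)
    (x : EuclideanSpace ℝ (Fin n)) (hx : x ∈ G) (r : ℝ) (hr : 0 < r) :
    ((closure {y | y ∈ G ∧ jStarMetric G x y < r} ∩ frontier G).Nonempty ↔ 1 ≤ r) ∧
    ((closure {y | y ∈ G ∧ pointPairFunction G x y < r} ∩ frontier G).Nonempty ↔ 1 ≤ r) ∧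
    ((closure {y | y ∈ G ∧ sMetric G x y < r} ∩ frontier G).Nonempty ↔ 1 ≤ r) := by
  have hF : (frontier G).Nonempty := nonempty_frontier_iff.2 ⟨hne, hproper⟩
  have hd := infDist_frontier_pos hopen hF hx
  have hball := ball_infDist_frontier_subset hopen hx
  have hxF : ∀ z ∈ frontier G, x ≠ z := by
    rintro _ hz rfl
    exact hd.ne' (Metric.infDist_zero_of_mem hz)
  refine ⟨⟨?_, fun h => ?_⟩, ⟨?_, fun h => ?_⟩, ⟨?_, fun h => ?_⟩⟩
  · rintro ⟨z, hcl, hz⟩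
    rw [← jStarMetric_of_mem_frontier (hxF z hz) hz]
    exact le_of_mem_closure_of_continuousAt hcl (continuousAt_jStarMetric (hxF z hz))
  · exact closure_inter_frontier_nonempty hF hd fun y hy =>
      ⟨hball hy, (jStarMetric_lt_one hd (infDist_frontier_pos hopen hF (hball hy))).trans_le h⟩
  · rintro ⟨z, hcl, hz⟩
    rw [← pointPairFunction_of_mem_frontier (hxF z hz) hz]
    exact le_of_mem_closure_of_continuousAt hcl (continuousAt_pointPairFunction (hxF z hz))
  · exact closure_inter_frontier_nonempty hF hd fun y hy =>
      ⟨hball hy,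
        (pointPairFunction_lt_one hd (infDist_frontier_pos hopen hF (hball hy))).trans_le h⟩
  · rintro ⟨z, hcl, hz⟩
    exact one_le_of_mem_closure_sMetric_lt hr hd (hxF z hz) hz hcl
  · exact closure_inter_frontier_nonempty hF hd fun y hy =>
      ⟨hball hy, (sMetric_lt_one hF (Metric.mem_ball'.1 hy)).trans_le h⟩
end
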